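/- (Corollary 2.6) Assume hypotheses (H1)–(H4), and assume the system is T-periodic for some T > 0, i.e. f(t+T, x, d) = f(t, x, d) for all (t,x,d). If 0 ∈ C([−r,0]; ℝⁿ) is non-uniformly in time RGAS, i.e. there exist σ ∈ KL and β ∈ K⁺ such that every maximal solution with initial data (t₀, x₀) ∈ [0,∞) × C([−r,0]; ℝⁿ) and d ∈ M_D is defined on all of [t₀,∞) and satisfies ‖T_r(t)x‖_r ≤ σ(β(t₀)‖x₀‖_r, t−t₀) for all t ≥ t₀, then 0 is URGAS: there exists σ̃ ∈ KL such that every such solution satisfies ‖T_r(t)x‖_r ≤ σ̃(‖x₀‖_r, t−t₀) for all t ≥ t₀ (one may take σ̃(s,t) := σ(ρ·s, t) with ρ := max_{0≤t≤T} β(t)). -/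

import Mathlib

open Set Filter MeasureTheory
open scoped RealInnerProductSpace

noncomputable section

/-- ℝⁿ with the Euclidean norm. -/
abbrev Euc (n : ℕ) : Type := EuclideanSpace ℝ (Fin n)

/-- The sup norm `‖y‖_q = max_{θ ∈ [-q,0]} |y θ|` of a history segment. -/
def histNorm (n : ℕ) (q : ℝ) (y : ℝ → Euc n) : ℝ :=
  sSup ((fun θ => ‖y θ‖) '' Icc (-q) 0)

/-- The class `M_D` of allowed disturbances: right-continuous maps `d : [0,∞) → D`
which are continuous outside a countable set with no finite accumulation point. -/
def MD (l : ℕ) (D : Set (Euc l)) (d : ℝ → Euc l) : Prop :=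
  (∀ t, 0 ≤ t → d t ∈ D) ∧
  (∀ t, 0 ≤ t → ∀ ε > 0, ∃ δ > 0, ∀ s, t ≤ s → s - t < δ → ‖d s - d t‖ < ε) ∧
  ∃ A : Set ℝ, (∀ C : ℝ, (A ∩ Icc 0 C).Finite) ∧
    ∀ t, 0 ≤ t → t ∉ A → ∀ ε > 0, ∃ δ > 0, ∀ s, 0 ≤ s → |s - t| < δ → ‖d s - d t‖ < ε

/-- The operator `E_h(x;v)`. -/
def Eop (n : ℕ) (x : ℝ → Euc n) (h : ℝ) (v : Euc n) : ℝ → Euc n :=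
  fun θ => if -h < θ then x 0 + (θ + h) • v else x (θ + h)

/-- The generalized (Dini-type) derivative
`V⁰(t,x;v) = limsup_{h→0⁺, y→0} (V(t+h, E_h(x;v)+h y) - V(t,x))/h` of a functional `V`
defined on `[0,∞) × C([-q,0];ℝⁿ)`, with values in the extended reals. -/
def Vdot (n : ℕ) (q : ℝ) (V : ℝ → (ℝ → Euc n) → ℝ) (t : ℝ)
    (x : ℝ → Euc n) (v : Euc n) : EReal :=
  ⨅ δ : Ioi (0:ℝ), ⨆ p : {p : ℝ × (ℝ → Euc n) //
      0 < p.1 ∧ p.1 < (δ : ℝ) ∧ ContinuousOn p.2 (Icc (-q) 0) ∧ histNorm n q p.2 < (δ : ℝ)},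
    (((V (t + p.1.1) (fun θ => Eop n x p.1.1 v θ + p.1.1 • p.1.2 θ) - V t x) / p.1.1 : ℝ) : EReal)

/-- The upper right Dini derivative `D⁺v(t) = limsup_{h→0⁺} (v(t+h)-v(t))/h`. -/
def DiniUpper (v : ℝ → ℝ) (t : ℝ) : EReal :=
  Filter.limsup (fun h => (((v (t + h) - v t) / h : ℝ) : EReal)) (nhdsWithin 0 (Ioi 0))

/-- Class `K∞` functions (on `[0,∞)`). -/
def IsKInf (a : ℝ → ℝ) : Prop :=
  ContinuousOn a (Ici 0) ∧ StrictMonoOn a (Ici 0) ∧ a 0 = 0 ∧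
  (∀ s, 0 ≤ s → 0 ≤ a s) ∧ Filter.Tendsto a Filter.atTop Filter.atTop

/-- Class `K⁺`: positive continuous functions on `[0,∞)`. -/
def IsKPlus (b : ℝ → ℝ) : Prop :=
  ContinuousOn b (Ici 0) ∧ ∀ t, 0 ≤ t → 0 < b t

/-- Class `KL` functions. -/
def IsKL (σ : ℝ → ℝ → ℝ) : Prop :=
  ContinuousOn (fun p : ℝ × ℝ => σ p.1 p.2) (Ici 0 ×ˢ Ici 0) ∧
  (∀ s t, 0 ≤ s → 0 ≤ t → 0 ≤ σ s t) ∧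
  (∀ t, 0 ≤ t → StrictMonoOn (fun s => σ s t) (Ici 0) ∧ σ 0 t = 0) ∧
  (∀ s, 0 ≤ s → AntitoneOn (σ s) (Ici 0)) ∧
  (∀ s, 0 ≤ s → Filter.Tendsto (σ s) Filter.atTop (nhds 0))

/-- Hypothesis (H1): a one-sided Lipschitz estimate. -/
def H1 (n l : ℕ) (r : ℝ) (D : Set (Euc l)) (f : ℝ → (ℝ → Euc n) → Euc l → Euc n) : Prop :=
  ∃ L : ℝ → ℝ → ℝ,
    ContinuousOn (fun p : ℝ × ℝ => L p.1 p.2) (Ici 0 ×ˢ Ici 0) ∧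
    (∀ t, 0 ≤ t → MonotoneOn (L t) (Ici 0)) ∧
    (∀ s, 0 ≤ s → MonotoneOn (fun t => L t s) (Ici 0)) ∧
    (∀ t s, 0 ≤ t → 0 ≤ s → 0 ≤ L t s) ∧
    ∀ t x y d, 0 ≤ t → ContinuousOn x (Icc (-r) 0) → ContinuousOn y (Icc (-r) 0) → d ∈ D →
      (inner ℝ (x 0 - y 0) (f t x d - f t y d) : ℝ) ≤
        L t (histNorm n r x + histNorm n r y) * (histNorm n r (x - y))^2

/-- Hypothesis (H2): `f` maps bounded sets to bounded sets, uniformly in `d ∈ D`. -/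
def H2 (n l : ℕ) (r : ℝ) (D : Set (Euc l)) (f : ℝ → (ℝ → Euc n) → Euc l → Euc n) : Prop :=
  ∀ Tb Rb : ℝ, ∃ C : ℝ, ∀ t x d, 0 ≤ t → t ≤ Tb → ContinuousOn x (Icc (-r) 0) →
    histNorm n r x ≤ Rb → d ∈ D → ‖f t x d‖ ≤ C

/-- Hypothesis (H3): continuity off a countable exceptional set of times with no finite
accumulation point, plus right-continuity in time everywhere. -/
def H3 (n l : ℕ) (r : ℝ) (D : Set (Euc l)) (f : ℝ → (ℝ → Euc n) → Euc l → Euc n) : Prop :=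
  ∃ A : Set ℝ, (∀ C : ℝ, (A ∩ Icc 0 C).Finite) ∧
    (∀ t x d, 0 ≤ t → t ∉ A → ContinuousOn x (Icc (-r) 0) → d ∈ D →
      ∀ ε > 0, ∃ δ > 0, ∀ t' x' d', 0 ≤ t' → ContinuousOn x' (Icc (-r) 0) → d' ∈ D →
        |t' - t| < δ → histNorm n r (x' - x) < δ → ‖d' - d‖ < δ →
          ‖f t' x' d' - f t x d‖ < ε) ∧
    (∀ t x d, 0 ≤ t → ContinuousOn x (Icc (-r) 0) → d ∈ D →
      ∀ ε > 0, ∃ δ > 0, ∀ t', t ≤ t' → t' - t < δ → ‖f t' x d - f t x d‖ < ε)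

/-- Hypothesis (H4). -/
def H4 (n l : ℕ) (r : ℝ) (D : Set (Euc l)) (f : ℝ → (ℝ → Euc n) → Euc l → Euc n) : Prop :=
  ∀ ε > 0, ∀ t, 0 ≤ t → ∃ δ > 0, ∀ τ x d, 0 ≤ τ → d ∈ D → ContinuousOn x (Icc (-r) 0) →
    |τ - t| + histNorm n r x < δ → ‖f τ x d‖ < ε

/-- A solution of the RFDE on `[t₀ - r, T)` (continuous, absolutely continuous on compact
subintervals of `[t₀,T)` and satisfying the equation a.e., expressed in integral form). -/
def IsSolIco (n l : ℕ) (r : ℝ) (f : ℝ → (ℝ → Euc n) → Euc l → Euc n) (d : ℝ → Euc l)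
    (t₀ T : ℝ) (x : ℝ → Euc n) : Prop :=
  ContinuousOn x (Ico (t₀ - r) T) ∧
  ∀ t ∈ Ico t₀ T,
    IntervalIntegrable (fun s => f s (fun θ => x (s + θ)) (d s)) volume t₀ t ∧
    x t = x t₀ + ∫ s in t₀..t, f s (fun θ => x (s + θ)) (d s)

/-- A solution of the RFDE on all of `[t₀ - r, ∞)`. -/
def IsSolGlobal (n l : ℕ) (r : ℝ) (f : ℝ → (ℝ → Euc n) → Euc l → Euc n) (d : ℝ → Euc l)
    (t₀ : ℝ) (x : ℝ → Euc n) : Prop :=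
  ContinuousOn x (Ici (t₀ - r)) ∧
  ∀ t, t₀ ≤ t →
    IntervalIntegrable (fun s => f s (fun θ => x (s + θ)) (d s)) volume t₀ t ∧
    x t = x t₀ + ∫ s in t₀..t, f s (fun θ => x (s + θ)) (d s)

/-- Non-uniform in time robust global asymptotic stability of `0` for the RFDE:
every maximal solution is defined on `[t₀,∞)` and satisfies the `KL` estimate (2.6). -/
def RGASnu (n l : ℕ) (r : ℝ) (D : Set (Euc l))
    (f : ℝ → (ℝ → Euc n) → Euc l → Euc n) : Prop :=
  ∃ σ : ℝ → ℝ → ℝ, ∃ β : ℝ → ℝ, IsKL σ ∧ IsKPlus β ∧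
    (∀ t₀ x₀ d, 0 ≤ t₀ → ContinuousOn x₀ (Icc (-r) 0) → MD l D d →
      ∃ x : ℝ → Euc n, IsSolGlobal n l r f d t₀ x ∧ ∀ θ ∈ Icc (-r) 0, x (t₀ + θ) = x₀ θ) ∧
    (∀ t₀ x₀ d x, 0 ≤ t₀ → ContinuousOn x₀ (Icc (-r) 0) → MD l D d →
      IsSolGlobal n l r f d t₀ x → (∀ θ ∈ Icc (-r) 0, x (t₀ + θ) = x₀ θ) →
      ∀ t, t₀ ≤ t →
        histNorm n r (fun θ => x (t + θ)) ≤ σ (β t₀ * histNorm n r x₀) (t - t₀))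

/-- Uniform robust global asymptotic stability of `0` for the RFDE. -/
def URGAS (n l : ℕ) (r : ℝ) (D : Set (Euc l))
    (f : ℝ → (ℝ → Euc n) → Euc l → Euc n) : Prop :=
  ∃ σ : ℝ → ℝ → ℝ, IsKL σ ∧
    (∀ t₀ x₀ d, 0 ≤ t₀ → ContinuousOn x₀ (Icc (-r) 0) → MD l D d →
      ∃ x : ℝ → Euc n, IsSolGlobal n l r f d t₀ x ∧ ∀ θ ∈ Icc (-r) 0, x (t₀ + θ) = x₀ θ) ∧
    (∀ t₀ x₀ d x, 0 ≤ t₀ → ContinuousOn x₀ (Icc (-r) 0) → MD l D d →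
      IsSolGlobal n l r f d t₀ x → (∀ θ ∈ Icc (-r) 0, x (t₀ + θ) = x₀ θ) →
      ∀ t, t₀ ≤ t →
        histNorm n r (fun θ => x (t + θ)) ≤ σ (histNorm n r x₀) (t - t₀))

lemma histNorm_nonneg (n : ℕ) (q : ℝ) (y : ℝ → Euc n) : 0 ≤ histNorm n q y := by
  apply Real.sSup_nonneg
  rintro _ ⟨θ, -, rfl⟩
  exact norm_nonneg _

/-- Rescaling the first argument of a `KL` function by a positive constant gives a `KL` function. -/
lemma IsKL.comp_mul_left {σ : ℝ → ℝ → ℝ} (hσ : IsKL σ) {ρ : ℝ} (hρ : 0 < ρ) :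
    IsKL fun s t => σ (ρ * s) t := by
  obtain ⟨hcont, hnonneg, hmono, hanti, hlim⟩ := hσ
  refine ⟨?_, fun s t hs ht => hnonneg _ _ (by positivity) ht, fun t ht => ⟨?_, ?_⟩,
    fun s hs => hanti _ (by positivity), fun s hs => hlim _ (by positivity)⟩
  · refine hcont.comp (f := fun p : ℝ × ℝ => (ρ * p.1, p.2)) (by fun_prop) ?_
    rintro ⟨s, t⟩ ⟨hs, ht⟩
    exact ⟨mul_nonneg hρ.le hs, ht⟩
  · intro a ha b hb hab
    exact (hmono t ht).1 (mul_nonneg hρ.le ha) (mul_nonneg hρ.le hb)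
      (mul_lt_mul_of_pos_left hab hρ)
  · simpa using (hmono t ht).2

/-- The class of disturbances is invariant under forward time shifts. -/
lemma MD.comp_add_right {l : ℕ} {D : Set (Euc l)} {d : ℝ → Euc l} (hd : MD l D d) {p : ℝ}
    (hp : 0 ≤ p) : MD l D fun t => d (t + p) := by
  obtain ⟨hmem, hright, A, hA, hcont⟩ := hd
  refine ⟨fun t ht => hmem _ (by positivity), fun t ht ε hε => ?_,
    (fun t => t + p) ⁻¹' A, fun C => ?_, fun t ht htA ε hε => ?_⟩
  · obtain ⟨δ, hδ, h⟩ := hright (t + p) (by positivity) ε hε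
    exact ⟨δ, hδ, fun s hs hsδ => h _ (by linarith) (by linarith)⟩
  · refine ((hA (C + p)).preimage (add_left_injective p).injOn).subset ?_
    rintro t ⟨htA, ht0, htC⟩
    exact ⟨htA, by linarith, by linarith⟩
  · obtain ⟨δ, hδ, h⟩ := hcont (t + p) (by positivity) htA ε hε
    exact ⟨δ, hδ, fun s hs hsδ => h _ (by positivity) (by simpa using hsδ)⟩

/-- A period of the right-hand side may be iterated. -/
lemma periodic_nat_mul {n l : ℕ} {r : ℝ} {D : Set (Euc l)}
    {f : ℝ → (ℝ → Euc n) → Euc l → Euc n} {T : ℝ} (hT : 0 ≤ T)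
    (hper : ∀ t x d, 0 ≤ t → ContinuousOn x (Icc (-r) 0) → d ∈ D → f (t + T) x d = f t x d)
    (k : ℕ) {t : ℝ} {x : ℝ → Euc n} {d : Euc l} (ht : 0 ≤ t)
    (hx : ContinuousOn x (Icc (-r) 0)) (hd : d ∈ D) : f (t + k * T) x d = f t x d := by
  induction k with
  | zero => simp
  | succ k ih =>
    rw [← ih, ← hper (t + k * T) x d (by positivity) hx hd]
    congr 1
    push_cast
    ring

/-- Shifting a solution backwards by a period `p` of the right-hand side gives a solution for the
shifted disturbance. -/
lemma IsSolGlobal.comp_add_right {n l : ℕ} {r : ℝ} {D : Set (Euc l)}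
    {f : ℝ → (ℝ → Euc n) → Euc l → Euc n} {d : ℝ → Euc l} {t₁ p : ℝ} {x : ℝ → Euc n}
    (hper : ∀ t x d, 0 ≤ t → ContinuousOn x (Icc (-r) 0) → d ∈ D → f (t + p) x d = f t x d)
    (ht₁ : 0 ≤ t₁) (hp : 0 ≤ p) (hd : ∀ t, 0 ≤ t → d t ∈ D)
    (hx : IsSolGlobal n l r f d (t₁ + p) x) :
    IsSolGlobal n l r f (fun t => d (t + p)) t₁ (fun t => x (t + p)) := by
  obtain ⟨hcont, hsol⟩ := hx
  have heq : ∀ s, t₁ ≤ s → f (s + p) (fun θ => x (s + p + θ)) (d (s + p)) =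
      f s (fun θ => x (s + θ + p)) (d (s + p)) := by
    intro s hs
    have hseg : (fun θ => x (s + p + θ)) = fun θ => x (s + θ + p) :=
      funext fun θ => by rw [add_right_comm]
    rw [hseg]
    refine hper s _ _ (ht₁.trans hs) ?_ (hd _ (by linarith))
    refine hcont.comp (f := fun θ => s + θ + p) (by fun_prop) fun θ hθ => ?_
    have := hθ.1
    simp only [mem_Ici]
    linarith
  refine ⟨?_, fun t ht => ?_⟩
  · refine hcont.comp (f := fun t => t + p) (by fun_prop) fun t ht => ?_
    simp only [mem_Ici] at ht ⊢
    linarith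
  · obtain ⟨hint, hval⟩ := hsol (t + p) (by linarith)
    have heqOn : EqOn (fun s => f (s + p) (fun θ => x (s + p + θ)) (d (s + p)))
        (fun s => f s (fun θ => x (s + θ + p)) (d (s + p))) (uIcc t₁ t) := by
      intro s hs
      rw [uIcc_of_le ht] at hs
      exact heq s hs.1
    constructor
    · have hshift := hint.comp_add_right p
      simp only [add_sub_cancel_right] at hshift
      exact hshift.congr (heqOn.mono uIoc_subset_uIcc)
    · dsimp only
      rw [hval, ← intervalIntegral.integral_congr heqOn,
        intervalIntegral.integral_comp_add_right
          (fun s => f s (fun θ => x (s + θ)) (d s)) p]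

/-- **Corollary 2.6.** Under hypotheses (H1)-(H4), if the system is
`T`-periodic and `0` is non-uniformly in time RGAS, then `0` is URGAS. -/
theorem stmt6 (n l : ℕ) (r : ℝ) (hr : 0 ≤ r) (D : Set (Euc l)) (hD : D.Nonempty)
    (f : ℝ → (ℝ → Euc n) → Euc l → Euc n)
    (hf0 : ∀ t d, 0 ≤ t → d ∈ D → f t (fun _ => (0 : Euc n)) d = 0)
    (h1 : H1 n l r D f) (h2 : H2 n l r D f) (h3 : H3 n l r D f) (h4 : H4 n l r D f)
    (T : ℝ) (hT : 0 < T)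
    (hper : ∀ t x d, 0 ≤ t → ContinuousOn x (Icc (-r) 0) → d ∈ D → f (t + T) x d = f t x d)
    (hrgas : RGASnu n l r D f) :
    URGAS n l r D f := by
  obtain ⟨σ, β, hσ, ⟨hβcont, hβpos⟩, hex, hest⟩ := hrgas
  obtain ⟨c, hc, hmax⟩ := isCompact_Icc.exists_isMaxOn (nonempty_Icc.2 hT.le)
    (hβcont.mono (Icc_subset_Ici_self : Icc 0 T ⊆ Ici 0))
  refine ⟨fun s t => σ (β c * s) t, hσ.comp_mul_left (hβpos c hc.1), hex, ?_⟩
  intro t₀ x₀ d x ht₀ hx₀ hd hx hinit t ht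
  have hk_le : (⌊t₀ / T⌋₊ : ℝ) * T ≤ t₀ :=
    (le_div_iff₀ hT).1 (Nat.floor_le (by positivity))
  have hk_lt : t₀ < (⌊t₀ / T⌋₊ + 1 : ℝ) * T := (div_lt_iff₀ hT).1 (Nat.lt_floor_add_one _)
  have hp : 0 ≤ (⌊t₀ / T⌋₊ : ℝ) * T := by positivity
  have hper' : ∀ t x d, 0 ≤ t → ContinuousOn x (Icc (-r) 0) → d ∈ D →
      f (t + ⌊t₀ / T⌋₊ * T) x d = f t x d :=
    fun t x d ht hx hd => periodic_nat_mul hT.le hper _ ht hx hd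
  set p : ℝ := ⌊t₀ / T⌋₊ * T with hp_def
  have ht₁ : 0 ≤ t₀ - p := sub_nonneg.2 hk_le
  have ht₁T : t₀ - p ≤ T := by linarith
  have hshift := hest (t₀ - p) x₀ (fun s => d (s + p)) (fun s => x (s + p)) ht₁ hx₀
    (hd.comp_add_right hp)
    (IsSolGlobal.comp_add_right hper' ht₁ hp hd.1 (by rwa [sub_add_cancel]))
    (fun θ hθ => by rw [← hinit θ hθ]; congr 1; ring) (t - p) (by linarith)
  have hseg : (fun θ => x (t - p + θ + p)) = fun θ => x (t + θ) :=
    funext fun θ => by congr 1; ring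
  rw [hseg, sub_sub_sub_cancel_right] at hshift
  have hN := histNorm_nonneg n r x₀
  exact hshift.trans (((hσ.2.2.1 (t - t₀) (sub_nonneg.2 ht)).1.monotoneOn)
    (mul_nonneg (hβpos _ ht₁).le hN) (mul_nonneg (hβpos c hc.1).le hN)
    (mul_le_mul_of_nonneg_right (hmax ⟨ht₁, ht₁T⟩) hN))

end
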